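/- Let ψ : ℝ → ℝ be infinitely smooth with ψ(s) = 1 for s ≤ 1/2 and ψ(s) = 0 for s ≥ 1, and let B₁ = sup over s ∈ ℝ of |ψ'(s)|. For 0 < ε < 1 define Φ_ε : ℝ² → ℝ by Φ_ε(x) = ψ(|ln‖x‖| / |ln ε|) for x ≠ 0 and Φ_ε(0) = 0. Then the integral over the unit ball {x ∈ ℝ² : ‖x‖ ≤ 1} of the squared Euclidean norm of the gradient satisfies ∫ ‖∇Φ_ε(x)‖² dx ≤ π B₁² / |ln ε|. -/

import Mathlib

open scoped Classical

/-- The cut-off function `Φ_ε(x) = ψ(|ln‖x‖| / |ln ε|)` for `x ≠ 0`, `Φ_ε(0) = 0`. -/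
noncomputable def cutoff (ψ : ℝ → ℝ) (ε : ℝ) (x : EuclideanSpace ℝ (Fin 2)) : ℝ :=
  if x = 0 then 0 else ψ (|Real.log ‖x‖| / |Real.log ε|)

open MeasureTheory Set Filter Topology

theorem deriv_eq_zero_of_notMem_Icc {ψ : ℝ → ℝ} (hψ1 : ∀ s : ℝ, s ≤ 1 / 2 → ψ s = 1)
    (hψ0 : ∀ s : ℝ, 1 ≤ s → ψ s = 0) {s : ℝ} (hs : s ∉ Icc (1 / 2 : ℝ) 1) :
    deriv ψ s = 0 := by
  rcases lt_or_ge s (1 / 2) with h | h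
  · have : ψ =ᶠ[𝓝 s] fun _ => 1 := by
      filter_upwards [Iio_mem_nhds h] with t ht using hψ1 t (le_of_lt ht)
    simp [this.deriv_eq]
  · have h1 : 1 < s := by
      by_contra! h1
      exact hs ⟨h, h1⟩
    have : ψ =ᶠ[𝓝 s] fun _ => 0 := by
      filter_upwards [Ioi_mem_nhds h1] with t ht using hψ0 t (le_of_lt ht)
    simp [this.deriv_eq]

theorem abs_deriv_le_iSup {ψ : ℝ → ℝ} (hψ : ContDiff ℝ (⊤ : ℕ∞) ψ)
    (hψ1 : ∀ s : ℝ, s ≤ 1 / 2 → ψ s = 1) (hψ0 : ∀ s : ℝ, 1 ≤ s → ψ s = 0) (s : ℝ) :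
    |deriv ψ s| ≤ ⨆ t : ℝ, |deriv ψ t| := by
  refine le_ciSup (f := fun t => |deriv ψ t|) ?_ s
  have hc : Continuous (deriv ψ) := hψ.continuous_deriv (by simp)
  have hs : HasCompactSupport (deriv ψ) :=
    HasCompactSupport.intro isCompact_Icc fun _ hx => deriv_eq_zero_of_notMem_Icc hψ1 hψ0 hx
  exact hc.abs.bddAbove_range_of_hasCompactSupport hs.norm

theorem norm_gradient_cutoff_le {ψ : ℝ → ℝ} (hψ : Differentiable ℝ ψ) {ε : ℝ}
    {x : EuclideanSpace ℝ (Fin 2)} (hx0 : x ≠ 0) (hx1 : ‖x‖ < 1) :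
    ‖gradient (cutoff ψ ε) x‖
      ≤ |deriv ψ (|Real.log ‖x‖| / |Real.log ε|)| / (|Real.log ε| * ‖x‖) := by
  have hx : 0 < ‖x‖ := norm_pos_iff.2 hx0
  have heq : cutoff ψ ε =ᶠ[𝓝 x] fun y => ψ (-Real.log ‖y‖ / |Real.log ε|) := by
    filter_upwards [isOpen_ne.mem_nhds hx0,
      continuous_norm.continuousAt.eventually_lt continuousAt_const hx1] with y hy0 hy1
    rw [cutoff, if_neg hy0, abs_of_nonpos (Real.log_nonpos (norm_nonneg y) hy1.le)]
  have hnorm : HasFDerivAt (fun y : EuclideanSpace ℝ (Fin 2) => ‖y‖) (fderiv ℝ norm x) x :=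
    ((contDiffAt_norm ℝ hx0).differentiableAt (n := 1) (by simp)).hasFDerivAt
  have hprofile : HasDerivAt (fun r : ℝ => ψ (-Real.log r / |Real.log ε|))
      (deriv ψ (-Real.log ‖x‖ / |Real.log ε|) * (-‖x‖⁻¹ / |Real.log ε|)) ‖x‖ :=
    (hψ _).hasDerivAt.comp _ ((Real.hasDerivAt_log hx.ne').neg.div_const _)
  have hfd := (hprofile.comp_hasFDerivAt x hnorm).congr_of_eventuallyEq heq
  have hle : ‖fderiv ℝ (norm : EuclideanSpace ℝ (Fin 2) → ℝ) x‖ ≤ 1 := by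
    simpa using norm_fderiv_le_of_lipschitz ℝ (x₀ := x)
      (lipschitzWith_one_norm (E := EuclideanSpace ℝ (Fin 2)))
  rw [gradient, LinearIsometryEquiv.norm_map, hfd.fderiv, norm_smul,
    abs_of_nonpos (Real.log_nonpos hx.le hx1.le)]
  refine (mul_le_of_le_one_right (norm_nonneg _) hle).trans_eq ?_
  rw [Real.norm_eq_abs, abs_mul, abs_div, abs_neg, abs_abs, abs_of_pos (inv_pos.2 hx)]
  simp only [div_eq_mul_inv, mul_inv]
  ring

theorem mem_Icc_sqrt_of_abs_log_div_mem {ε r : ℝ} (hε : 0 < ε) (hε1 : ε < 1) (hr : 0 < r)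
    (hr1 : r < 1) (h : |Real.log r| / |Real.log ε| ∈ Icc (1 / 2 : ℝ) 1) :
    r ∈ Icc ε (√ε) := by
  have hL := Real.log_neg hε hε1
  rw [abs_of_neg (Real.log_neg hr hr1), abs_of_neg hL] at h
  obtain ⟨h1, h2⟩ := h
  rw [le_div_iff₀ (by linarith)] at h1
  rw [div_le_one (by linarith)] at h2
  refine ⟨(Real.log_le_log_iff hε hr).1 (by linarith),
    (Real.log_le_log_iff hr (Real.sqrt_pos.2 hε)).1 ?_⟩
  rw [Real.log_sqrt hε.le]
  linarith

theorem self_le_sqrt_of_le_one {ε : ℝ} (hε : 0 ≤ ε) (hε1 : ε ≤ 1) : ε ≤ √ε :=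
  Real.le_sqrt_of_sq_le (by nlinarith)

/-- The radial profile dominating the squared gradient of the cut-off. -/
noncomputable def radialBound (C ε : ℝ) : ℝ → ℝ :=
  (Icc ε (√ε)).indicator fun r => (C / r) ^ 2

theorem radialBound_nonneg (C ε r : ℝ) : 0 ≤ radialBound C ε r :=
  indicator_nonneg (fun _ _ => sq_nonneg _) r

theorem pow_one_smul_radialBound {ε : ℝ} (hε : 0 < ε) (C : ℝ) :
    (fun r : ℝ => r ^ (2 - 1) • radialBound C ε r)
      = (Icc ε (√ε)).indicator fun r => C ^ 2 * r⁻¹ := by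
  funext r
  by_cases hr : r ∈ Icc ε (√ε)
  · have : r ≠ 0 := (hε.trans_le hr.1).ne'
    simp only [radialBound, indicator_of_mem hr, smul_eq_mul]
    field_simp
    ring
  · simp [radialBound, hr]

theorem integrable_radialBound_norm {ε : ℝ} (hε : 0 < ε) (C : ℝ) :
    Integrable fun x : EuclideanSpace ℝ (Fin 2) => radialBound C ε ‖x‖ := by
  rw [integrable_fun_norm_addHaar volume (f := radialBound C ε), finrank_euclideanSpace_fin,
    pow_one_smul_radialBound hε]
  refine Integrable.integrableOn ((integrable_indicator_iff measurableSet_Icc).2 ?_)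
  refine ContinuousOn.integrableOn_Icc (continuousOn_const.mul ?_)
  exact continuousOn_inv₀.mono fun r hr => (hε.trans_le hr.1).ne'

theorem integral_radialBound_norm {ε : ℝ} (hε : 0 < ε) (hε1 : ε < 1) (C : ℝ) :
    ∫ x : EuclideanSpace ℝ (Fin 2), radialBound C ε ‖x‖ = Real.pi * C ^ 2 * |Real.log ε| := by
  have hball : volume.real (Metric.ball (0 : EuclideanSpace ℝ (Fin 2)) 1) = Real.pi := by
    simp [Measure.real, Real.pi_nonneg]
  have hsub : Icc ε (√ε) ⊆ Ioi 0 := fun r hr => hε.trans_le hr.1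
  rw [integral_fun_norm_addHaar volume (radialBound C ε), finrank_euclideanSpace_fin,
    pow_one_smul_radialBound hε, setIntegral_indicator measurableSet_Icc,
    inter_eq_right.2 hsub, integral_const_mul, integral_Icc_eq_integral_Ioc,
    ← intervalIntegral.integral_of_le (self_le_sqrt_of_le_one hε.le hε1.le),
    integral_inv_of_pos hε (Real.sqrt_pos.2 hε),
    Real.log_div (Real.sqrt_pos.2 hε).ne' hε.ne', Real.log_sqrt hε.le, hball,
    abs_of_neg (Real.log_neg hε hε1)]
  simp only [nsmul_eq_mul, smul_eq_mul]
  push_cast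
  ring

theorem sq_norm_gradient_cutoff_le_radialBound {ψ : ℝ → ℝ} (hψ : ContDiff ℝ (⊤ : ℕ∞) ψ)
    (hψ1 : ∀ s : ℝ, s ≤ 1 / 2 → ψ s = 1) (hψ0 : ∀ s : ℝ, 1 ≤ s → ψ s = 0)
    {ε : ℝ} (hε : 0 < ε) (hε1 : ε < 1) {x : EuclideanSpace ℝ (Fin 2)} (hx0 : x ≠ 0)
    (hx1 : ‖x‖ < 1) :
    ‖gradient (cutoff ψ ε) x‖ ^ 2
      ≤ radialBound ((⨆ s : ℝ, |deriv ψ s|) / |Real.log ε|) ε ‖x‖ := by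
  have hgrad := norm_gradient_cutoff_le (hψ.differentiable (by simp)) (ε := ε) hx0 hx1
  by_cases hs : |Real.log ‖x‖| / |Real.log ε| ∈ Icc (1 / 2 : ℝ) 1
  · rw [radialBound, indicator_of_mem
      (mem_Icc_sqrt_of_abs_log_div_mem hε hε1 (norm_pos_iff.2 hx0) hx1 hs), div_div]
    gcongr
    refine hgrad.trans ?_
    gcongr
    exact abs_deriv_le_iSup hψ hψ1 hψ0 _
  · rw [deriv_eq_zero_of_notMem_Icc hψ1 hψ0 hs, abs_zero, zero_div] at hgrad
    rw [le_antisymm hgrad (norm_nonneg _), zero_pow two_ne_zero]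
    exact radialBound_nonneg _ _ _

theorem stmt12 (ψ : ℝ → ℝ) (hψ : ContDiff ℝ (⊤ : ℕ∞) ψ)
    (hψ1 : ∀ s : ℝ, s ≤ 1 / 2 → ψ s = 1) (hψ0 : ∀ s : ℝ, 1 ≤ s → ψ s = 0)
    (B₁ : ℝ) (hB₁ : B₁ = ⨆ s : ℝ, |deriv ψ s|)
    (ε : ℝ) (hε : 0 < ε) (hε1 : ε < 1) :
    ∫ x in Metric.closedBall (0 : EuclideanSpace ℝ (Fin 2)) 1,
        ‖gradient (cutoff ψ ε) x‖ ^ 2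
      ≤ Real.pi * B₁ ^ 2 / |Real.log ε| := by
  subst hB₁
  set C := (⨆ s : ℝ, |deriv ψ s|) / |Real.log ε| with hC
  have hL : |Real.log ε| ≠ 0 := abs_ne_zero.2 (Real.log_neg hε hε1).ne
  have hint := integrable_radialBound_norm hε C
  have hsphere : ∀ᵐ x : EuclideanSpace ℝ (Fin 2), x ∉ Metric.sphere 0 1 :=
    measure_eq_zero_iff_ae_notMem.1 (Measure.addHaar_sphere volume 0 1)
  have hzero : ∀ᵐ x : EuclideanSpace ℝ (Fin 2), x ≠ 0 := Measure.ae_ne volume 0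
  calc ∫ x in Metric.closedBall (0 : EuclideanSpace ℝ (Fin 2)) 1,
        ‖gradient (cutoff ψ ε) x‖ ^ 2
      ≤ ∫ x in Metric.closedBall (0 : EuclideanSpace ℝ (Fin 2)) 1, radialBound C ε ‖x‖ := by
        refine integral_mono_of_nonneg (ae_of_all _ fun _ => sq_nonneg _) hint.integrableOn ?_
        filter_upwards [ae_restrict_mem Metric.isClosed_closedBall.measurableSet,
          ae_restrict_of_ae hsphere, ae_restrict_of_ae hzero] with x hx hxs hx0
        rw [mem_closedBall_zero_iff] at hx
        rw [mem_sphere_zero_iff_norm] at hxs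
        exact sq_norm_gradient_cutoff_le_radialBound hψ hψ1 hψ0 hε hε1 hx0 (hx.lt_of_ne hxs)
    _ ≤ ∫ x : EuclideanSpace ℝ (Fin 2), radialBound C ε ‖x‖ :=
        setIntegral_le_integral hint (ae_of_all _ fun _ => radialBound_nonneg _ _ _)
    _ = Real.pi * (⨆ s : ℝ, |deriv ψ s|) ^ 2 / |Real.log ε| := by
        rw [integral_radialBound_norm hε hε1, hC]
        field_simp
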